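/- arXiv:1609.01016 — 2 statements merged into one kernel-verified Lean document; each statement's English description precedes it below -/
import Mathlib

section
/- Let A be a set with 58 ≤ |A| ≤ ℵ₀ and |A| even (where ℵ₀ is regarded as even; so either |A| is a finite even number at least 58, or |A| = ℵ₀). Then the complete lattice Quo(A) of all quasiorders on A is (1+1+2)-generated. -/
universe u

open Set

/-- The diagonal (equality) relation on `α`, as a set of pairs. -/
def diagRel (α : Type u) : Set (α × α) := {p | p.1 = p.2}

/-- A quasiorder (preorder): a reflexive and transitive binary relation, as a set of pairs. -/
def IsQuoRel {α : Type u} (r : Set (α × α)) : Prop :=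
  (∀ a : α, (a, a) ∈ r) ∧ ∀ a b c : α, (a, b) ∈ r → (b, c) ∈ r → (a, c) ∈ r

/-- A transitive binary relation, as a set of pairs. -/
def IsTranRel {α : Type u} (r : Set (α × α)) : Prop :=
  ∀ a b c : α, (a, b) ∈ r → (b, c) ∈ r → (a, c) ∈ r

/-- An equivalence relation, as a set of pairs. -/
def IsEquRel {α : Type u} (r : Set (α × α)) : Prop :=
  IsQuoRel r ∧ ∀ p : α × α, p ∈ r → (p.2, p.1) ∈ r

/-- `Quo(α)`: the set of all quasiorders on `α`. -/
def QuoRels (α : Type u) : Set (Set (α × α)) := {r | IsQuoRel r}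

/-- `Tran(α)`: the set of all transitive relations on `α`. -/
def TranRels (α : Type u) : Set (Set (α × α)) := {r | IsTranRel r}

/-- `Equ(α)`: the set of all equivalence relations on `α`. -/
def EquRels (α : Type u) : Set (Set (α × α)) := {r | IsEquRel r}

/-- The least quasiorder containing `r` (the reflexive-transitive closure of `r`). -/
def quoGen {α : Type u} (r : Set (α × α)) : Set (α × α) := ⋂₀ {s | IsQuoRel s ∧ r ⊆ s}

/-- The least transitive relation containing `r` (the transitive closure of `r`). -/
def tranGen {α : Type u} (r : Set (α × α)) : Set (α × α) := ⋂₀ {s | IsTranRel s ∧ r ⊆ s}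

/-- The least equivalence relation containing `r`. -/
def equGen {α : Type u} (r : Set (α × α)) : Set (α × α) := ⋂₀ {s | IsEquRel s ∧ r ⊆ s}

/-- `quo(a,b)`: the least quasiorder containing the pair `(a,b)`. -/
def quoPair {α : Type u} (a b : α) : Set (α × α) := quoGen {(a, b)}

/-- `equ(a,b)`: the least equivalence relation containing the pair `(a,b)`. -/
def equPair {α : Type u} (a b : α) : Set (α × α) := equGen {(a, b)}

/-- The involution: the inverse of a relation. -/
def invRel {α : Type u} (r : Set (α × α)) : Set (α × α) := {p | (p.2, p.1) ∈ r}

/-- `T` is closed under arbitrary (possibly infinite, possibly empty) joins and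
meets of the complete lattice `Quo(α)`: the meet of a family of quasiorders is its
intersection and the join is the quasiorder generated by its union. -/
def QuoClosed {α : Type u} (T : Set (Set (α × α))) : Prop :=
  (∀ S ⊆ T, quoGen (⋃₀ S) ∈ T) ∧ (∀ S ⊆ T, ⋂₀ S ∈ T)

/-- `X` generates the complete lattice `Quo(α)` in the complete sense. -/
def QuoGenerates {α : Type u} (X : Set (Set (α × α))) : Prop :=
  X ⊆ QuoRels α ∧ ∀ T ⊆ QuoRels α, X ⊆ T → QuoClosed T → T = QuoRels α

/-- `T` is closed under arbitrary joins and meets of the complete lattice `Tran(α)`. -/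
def TranClosed {α : Type u} (T : Set (Set (α × α))) : Prop :=
  (∀ S ⊆ T, tranGen (⋃₀ S) ∈ T) ∧ (∀ S ⊆ T, ⋂₀ S ∈ T)

/-- `X` generates the complete lattice `Tran(α)` in the complete sense. -/
def TranGenerates {α : Type u} (X : Set (Set (α × α))) : Prop :=
  X ⊆ TranRels α ∧ ∀ T ⊆ TranRels α, X ⊆ T → TranClosed T → T = TranRels α

/-- `X` generates `Quo(α)` as a complete involution lattice. -/
def QuoInvGenerates {α : Type u} (X : Set (Set (α × α))) : Prop :=
  X ⊆ QuoRels α ∧ ∀ T ⊆ QuoRels α, X ⊆ T → QuoClosed T →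
    (∀ r ∈ T, invRel r ∈ T) → T = QuoRels α

/-- `X` generates `Tran(α)` as a complete involution lattice. -/
def TranInvGenerates {α : Type u} (X : Set (Set (α × α))) : Prop :=
  X ⊆ TranRels α ∧ ∀ T ⊆ TranRels α, X ⊆ T → TranClosed T →
    (∀ r ∈ T, invRel r ∈ T) → T = TranRels α

/-- Incomparability (with respect to inclusion). -/
def Incomp {α : Type u} (a b : Set (α × α)) : Prop := ¬ a ⊆ b ∧ ¬ b ⊆ a

/-- The complete lattice `Quo(α)` is `(1+1+2)`-generated: it is generated, in the
complete sense, by a four-element set `{x₁,x₂,x₃,x₄}` with `x₁ < x₂` such that both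
`{x₁,x₃,x₄}` and `{x₂,x₃,x₄}` are antichains. -/
def QuoOneOneTwoGenerated (α : Type u) : Prop :=
  ∃ x₁ x₂ x₃ x₄ : Set (α × α),
    x₁ ⊂ x₂ ∧ Incomp x₁ x₃ ∧ Incomp x₁ x₄ ∧ Incomp x₂ x₃ ∧ Incomp x₂ x₄ ∧
    Incomp x₃ x₄ ∧ QuoGenerates {x₁, x₂, x₃, x₄}

/-- A cardinal is accessible: it is finite, or it is infinite and every cardinal
`lam ≤ κ` satisfies `lam ≤ 2 ^ μ` for some `μ < lam`, or is at most a sum of fewer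
than `lam` many cardinals each smaller than `lam`. -/
def AccessibleCard (κ : Cardinal.{u}) : Prop :=
  κ < Cardinal.aleph0 ∨
    (Cardinal.aleph0 ≤ κ ∧ ∀ lam : Cardinal.{u}, lam ≤ κ →
      (∃ μ : Cardinal.{u}, μ < lam ∧ lam ≤ 2 ^ μ) ∨
      ∃ (ι : Type u) (f : ι → Cardinal.{u}),
        Cardinal.mk ι < lam ∧ (∀ i : ι, f i < lam) ∧ lam ≤ Cardinal.sum f)

section JoinWithPairs

variable {α : Type u}

theorem isQuoRel_diagRel : IsQuoRel (diagRel α) :=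
  ⟨fun _ => rfl, fun _ _ _ h₁ h₂ => Eq.trans h₁ h₂⟩

theorem quoGen_eq_of_isLeast {r s : Set (α × α)} (hs : IsQuoRel s) (hrs : r ⊆ s)
    (hmin : ∀ t, IsQuoRel t → r ⊆ t → s ⊆ t) : quoGen r = s :=
  Subset.antisymm (sInter_subset_of_mem ⟨hs, hrs⟩)
    (subset_sInter fun t ht => hmin t ht.1 ht.2)

/-- The join of a quasiorder `X` with the quasiorder generated by the pair `p`. -/
def addPair (X : Set (α × α)) (p : α × α) : Set (α × α) :=
  {q | q ∈ X ∨ (q.1, p.1) ∈ X ∧ (p.2, q.2) ∈ X}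

/-- The join of a quasiorder `X` with the quasiorder generated by the pairs in `L`. -/
def addPairs (X : Set (α × α)) (L : List (α × α)) : Set (α × α) :=
  L.foldl addPair X

theorem IsQuoRel.addPair {X : Set (α × α)} (hX : IsQuoRel X) (p : α × α) :
    IsQuoRel (addPair X p) := by
  refine ⟨fun a => Or.inl (hX.1 a), ?_⟩
  rintro a b c (h | ⟨h, h'⟩) (k | ⟨k, k'⟩)
  · exact Or.inl (hX.2 _ _ _ h k)
  · exact Or.inr ⟨hX.2 _ _ _ h k, k'⟩
  · exact Or.inr ⟨h, hX.2 _ _ _ h' k⟩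
  · exact Or.inr ⟨h, k'⟩

theorem IsQuoRel.addPairs {X : Set (α × α)} (hX : IsQuoRel X) (L : List (α × α)) :
    IsQuoRel (addPairs X L) := by
  induction L generalizing X with
  | nil => exact hX
  | cons p L ih => exact ih (hX.addPair p)

theorem subset_addPairs (X : Set (α × α)) (L : List (α × α)) : X ⊆ addPairs X L := by
  induction L generalizing X with
  | nil => exact Subset.rfl
  | cons p L ih => exact Subset.trans (fun _ => Or.inl) (ih (addPair X p))

theorem mem_addPairs_of_mem {X : Set (α × α)} (hX : IsQuoRel X) {L : List (α × α)} {p : α × α}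
    (hp : p ∈ L) : p ∈ addPairs X L := by
  induction L generalizing X with
  | nil => simp at hp
  | cons r L ih =>
    rcases List.mem_cons.1 hp with rfl | h
    · exact subset_addPairs _ L (Or.inr ⟨hX.1 _, hX.1 _⟩)
    · exact ih (hX.addPair r) h

theorem addPairs_subset {X S : Set (α × α)} (hS : IsQuoRel S) {L : List (α × α)} (hXS : X ⊆ S)
    (hL : ∀ p ∈ L, p ∈ S) : addPairs X L ⊆ S := by
  induction L generalizing X with
  | nil => exact hXS
  | cons p L ih =>
    refine ih ?_ fun r hr => hL r (List.mem_cons_of_mem _ hr)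
    rintro ⟨a, b⟩ (h | ⟨h, h'⟩)
    · exact hXS h
    · exact hS.2 _ _ _ (hXS h) (hS.2 _ _ _ (hL p List.mem_cons_self) (hXS h'))

theorem diagRel_subset {X : Set (α × α)} (hX : IsQuoRel X) : diagRel α ⊆ X := by
  rintro ⟨a, b⟩ h
  obtain rfl : a = b := h
  exact hX.1 a

/-- The quasiorder whose only possible pair off the diagonal is `(a, b)`. -/
def atomRel (a b : α) : Set (α × α) := addPair (diagRel α) (a, b)

theorem mem_atomRel (a b : α) : (a, b) ∈ atomRel a b := Or.inr ⟨rfl, rfl⟩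

theorem isQuoRel_atomRel (a b : α) : IsQuoRel (atomRel a b) := isQuoRel_diagRel.addPair _

theorem atomRel_subset {X : Set (α × α)} (hX : IsQuoRel X) {a b : α} (h : (a, b) ∈ X) :
    atomRel a b ⊆ X :=
  addPairs_subset (L := [(a, b)]) hX (diagRel_subset hX) (by simpa using h)

variable {T : Set (Set (α × α))}

theorem QuoClosed.diagRel_mem (hT : QuoClosed T) : diagRel α ∈ T := by
  have h := hT.1 ∅ (empty_subset _)
  rwa [quoGen_eq_of_isLeast isQuoRel_diagRel (by simp) fun t ht _ => diagRel_subset ht] at h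

theorem QuoClosed.inter_mem (hT : QuoClosed T) {X Y : Set (α × α)} (hX : X ∈ T) (hY : Y ∈ T) :
    X ∩ Y ∈ T := by
  rw [← sInter_pair]
  exact hT.2 _ (by rintro _ (rfl | rfl) <;> assumption)

theorem QuoClosed.addPairs_mem (hT : QuoClosed T) {X : Set (α × α)} {L : List (α × α)}
    (hX : X ∈ T) (hXq : IsQuoRel X) (hL : addPairs (diagRel α) L ∈ T) : addPairs X L ∈ T := by
  have h := hT.1 {X, addPairs (diagRel α) L} (by rintro _ (rfl | rfl) <;> assumption)
  rw [sUnion_pair] at h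
  rwa [quoGen_eq_of_isLeast (hXq.addPairs L)] at h
  · exact union_subset (subset_addPairs X L)
      (addPairs_subset (hXq.addPairs L) (diagRel_subset (hXq.addPairs L))
        fun p hp => mem_addPairs_of_mem hXq hp)
  · intro t ht hrt
    exact addPairs_subset ht (subset_union_left.trans hrt) fun p hp =>
      hrt (Or.inr (mem_addPairs_of_mem isQuoRel_diagRel hp))

theorem QuoClosed.mem_of_atomRel_mem (hT : QuoClosed T) (h : ∀ a b, atomRel a b ∈ T)
    {r : Set (α × α)} (hr : IsQuoRel r) : r ∈ T := by
  have := hT.1 ((fun p : α × α => atomRel p.1 p.2) '' r) (by rintro _ ⟨p, -, rfl⟩; exact h _ _)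
  rwa [quoGen_eq_of_isLeast hr] at this
  · rintro p ⟨_, ⟨⟨a, b⟩, hq, rfl⟩, hp⟩
    exact atomRel_subset hr hq hp
  · rintro t - hsub ⟨a, b⟩ hp
    exact hsub ⟨_, ⟨_, hp, rfl⟩, mem_atomRel a b⟩

end JoinWithPairs

section Matrices

variable {α : Type u} {k : ℕ}

/-- `addPairs`, for relations on `Fin k` given by Boolean matrices. -/
def addPairsMat (x : Fin k → Fin k → Bool) (L : List (Fin k × Fin k)) : Fin k → Fin k → Bool :=
  L.foldl (fun x p i j => x i j || (x i p.1 && x p.2 j)) x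

/-- The identity matrix. -/
def diagMat (k : ℕ) : Fin k → Fin k → Bool := fun i j => decide (i = j)

/-- The quasiorder generated by the images under `e` of the pairs in `L`. -/
def finRel (e : Fin k → α) (L : List (Fin k × Fin k)) : Set (α × α) :=
  addPairs (diagRel α) (L.map (Prod.map e e))

/-- `X` is a quasiorder that induces the matrix `x` along `e`, and agrees with a subset of `X₀`
away from the image of `e`. -/
structure IsLocal (e : Fin k → α) (X₀ X : Set (α × α)) (x : Fin k → Fin k → Bool) : Prop where
  isQuoRel : IsQuoRel X
  mem_iff : ∀ i j, (e i, e j) ∈ X ↔ x i j = true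
  outside : ∀ a b, a ∉ range e ∨ b ∉ range e → (a, b) ∈ X → (a, b) ∈ X₀

/-- `X` is a quasiorder in `T` that induces the matrix `x` along `e` and does not relate any of
the first `c` points of the image of `e` to points outside the image. -/
structure IsBase (T : Set (Set (α × α))) (e : Fin k → α) (c : ℕ) (X : Set (α × α))
    (x : Fin k → Fin k → Bool) : Prop where
  mem : X ∈ T
  isQuoRel : IsQuoRel X
  mem_iff : ∀ i j, (e i, e j) ∈ X ↔ x i j = true
  isolated : ∀ a ∉ range e, ∀ i : Fin k, i.val < c → (a, e i) ∉ X ∧ (e i, a) ∉ X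

theorem isBase_diagRel {T : Set (Set (α × α))} (hT : QuoClosed T) {e : Fin k → α}
    (he : Function.Injective e) : IsBase T e k (diagRel α) (diagMat k) where
  mem := hT.diagRel_mem
  isQuoRel := isQuoRel_diagRel
  mem_iff i j := by simp [diagRel, diagMat, he.eq_iff]
  isolated a ha i _ := ⟨fun h => ha ⟨i, Eq.symm h⟩, fun h => ha ⟨i, h⟩⟩

theorem IsBase.isLocal_addPairs {T : Set (Set (α × α))} {e : Fin k → α} {c : ℕ}
    {X₀ : Set (α × α)} {x₀ : Fin k → Fin k → Bool} (h₀ : IsBase T e c X₀ x₀)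
    {L : List (Fin k × Fin k)} (hL : ∀ p ∈ L, p.1.val < c ∧ p.2.val < c) :
    IsLocal e X₀ (addPairs X₀ (L.map (Prod.map e e))) (addPairsMat x₀ L) := by
  suffices H : ∀ X x, IsLocal e X₀ X x →
      IsLocal e X₀ (addPairs X (L.map (Prod.map e e))) (addPairsMat x L) from
    H X₀ x₀ ⟨h₀.isQuoRel, h₀.mem_iff, fun _ _ _ h => h⟩
  induction L with
  | nil => exact fun X x h => h
  | cons p L ih =>
    intro X x h
    refine ih (fun r hr => hL r (List.mem_cons_of_mem _ hr)) _ _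
      ⟨h.isQuoRel.addPair _, fun i j => ?_, ?_⟩
    · simp [addPair, ← h.mem_iff]
    · obtain ⟨hp₁, hp₂⟩ := hL p List.mem_cons_self
      rintro a b hab (hm | ⟨hm₁, hm₂⟩)
      · exact h.outside a b hab hm
      · rcases hab with ha | hb
        · exact absurd (h.outside _ _ (Or.inl ha) hm₁) (h₀.isolated a ha _ hp₁).1
        · exact absurd (h.outside _ _ (Or.inr hb) hm₂) (h₀.isolated b hb _ hp₂).2

variable {T : Set (Set (α × α))} {e : Fin k → α}

theorem QuoClosed.finRel_append_mem (hT : QuoClosed T) {L M : List (Fin k × Fin k)}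
    (hL : finRel e L ∈ T) (hM : finRel e M ∈ T) : finRel e (L ++ M) ∈ T := by
  have := hT.addPairs_mem hL (isQuoRel_diagRel.addPairs _) hM
  rwa [addPairs, finRel, addPairs, ← List.foldl_append, ← List.map_append] at this

/-- A relation `finRel e M` belongs to `T` once it is seen, by a matrix computation, to be the
meet of two joins of members of `T`. -/
theorem QuoClosed.finRel_mem (hT : QuoClosed T) (he : Function.Injective e) {c d : ℕ}
    {X Y : Set (α × α)} {x y : Fin k → Fin k → Bool} (hX : IsBase T e c X x)
    (hY : IsBase T e d Y y) (hXY : X ∩ Y ⊆ diagRel α) {L L' : List (Fin k × Fin k)}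
    (hL : finRel e L ∈ T) (hL' : finRel e L' ∈ T) {M : List (Fin k × Fin k)}
    (h : (∀ p ∈ L, p.1.val < c ∧ p.2.val < c) ∧ (∀ p ∈ L', p.1.val < d ∧ p.2.val < d) ∧
      ∀ i j, (addPairsMat x L i j && addPairsMat y L' i j) = addPairsMat (diagMat k) M i j) :
    finRel e M ∈ T := by
  have lX := hX.isLocal_addPairs h.1
  have lY := hY.isLocal_addPairs h.2.1
  have lM := (isBase_diagRel hT he).isLocal_addPairs (L := M) fun p _ => ⟨p.1.isLt, p.2.isLt⟩
  have key := hT.inter_mem (hT.addPairs_mem hX.mem hX.isQuoRel hL)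
    (hT.addPairs_mem hY.mem hY.isQuoRel hL')
  convert key using 1
  ext ⟨a, b⟩
  by_cases hab : a ∉ range e ∨ b ∉ range e
  · constructor
    · exact fun hm => ⟨diagRel_subset lX.isQuoRel (lM.outside a b hab hm),
        diagRel_subset lY.isQuoRel (lM.outside a b hab hm)⟩
    · exact fun hm => diagRel_subset lM.isQuoRel
        (hXY ⟨lX.outside a b hab hm.1, lY.outside a b hab hm.2⟩)
  · push Not at hab
    obtain ⟨⟨i, rfl⟩, j, rfl⟩ := hab
    rw [mem_inter_iff, lX.mem_iff, lY.mem_iff, finRel, lM.mem_iff, ← h.2.2 i j, Bool.and_eq_true]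

end Matrices

section Seed

variable {α : Type u} {T : Set (Set (α × α))} {e : Fin 9 → α}

/-- The initial phase: from the equivalences `A`, `B`, `G` with classes of the same parity,
`{2i, 2i+1}` and `{2i-1, 2i}`, and one finite quasiorder, to all atoms on four points. -/
theorem QuoClosed.finRel_mem_seed (hT : QuoClosed T) (he : Function.Injective e)
    {A B G : Set (α × α)}
    (hA : IsBase T e 0 A fun i j => decide (i.val % 2 = j.val % 2))
    (hB : IsBase T e 8 B fun i j => decide (i.val / 2 = j.val / 2))
    (hG : IsBase T e 8 G fun i j => decide ((i.val + 1) / 2 = (j.val + 1) / 2))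
    (hAB : A ∩ B ⊆ diagRel α) (hAG : A ∩ G ⊆ diagRel α) (hBG : B ∩ G ⊆ diagRel α)
    (hD : finRel e [(0, 2), (3, 1), (3, 5), (6, 4)] ∈ T) (i j : Fin 9)
    (hi : 1 ≤ i.val ∧ i.val ≤ 4) (hj : 1 ≤ j.val ∧ j.val ≤ 4) (hij : i ≠ j) :
    finRel e [(i, j)] ∈ T := by
  have hE := isBase_diagRel hT he
  have h₀ : finRel e [] ∈ T := hT.diagRel_mem
  have h1 : finRel e [(0, 1), (3, 2), (4, 5), (5, 4)] ∈ T :=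
    hT.finRel_mem he hB hG hBG h₀ hD (by decide +kernel)
  have h2 : finRel e [(3, 4), (6, 5)] ∈ T :=
    hT.finRel_mem he hE hG inter_subset_left (hT.finRel_append_mem h1 hD) h₀ (by decide +kernel)
  have h3 : finRel e [(1, 2), (2, 1), (3, 4), (6, 5)] ∈ T :=
    hT.finRel_mem he hB hG hBG hD h₀ (by decide +kernel)
  have h4 : finRel e [(0, 1), (3, 2)] ∈ T :=
    hT.finRel_mem he hE hB inter_subset_left (hT.finRel_append_mem h3 hD) h₀ (by decide +kernel)
  have h5 : finRel e [(0, 2), (3, 1)] ∈ T :=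
    hT.finRel_mem he hE hE inter_subset_left (hT.finRel_append_mem h4 h3) hD (by decide +kernel)
  have h6 : finRel e [(1, 2), (2, 1)] ∈ T :=
    hT.finRel_mem he hB hG hBG h5 h₀ (by decide +kernel)
  have h7 : finRel e [(0, 2), (3, 5), (4, 6), (5, 1), (5, 3), (6, 2), (6, 4)] ∈ T :=
    hT.finRel_mem he hA hG hAG h₀ hD (by decide +kernel)
  have h8 : finRel e [(2, 4), (3, 5), (6, 4), (7, 5)] ∈ T :=
    hT.finRel_mem he hA hB hAB h₀ h2 (by decide +kernel)
  have h9 : finRel e [(0, 2), (3, 1), (4, 2)] ∈ T :=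
    hT.finRel_mem he hA hG hAG h₀ h4 (by decide +kernel)
  have h10 : finRel e [(0, 2), (1, 3), (2, 0), (3, 1)] ∈ T :=
    hT.finRel_mem he hA hB hAB h₀ h5 (by decide +kernel)
  have a32 : finRel e [(3, 2)] ∈ T :=
    hT.finRel_mem he hE hB inter_subset_left (hT.finRel_append_mem h9 h2) h₀ (by decide +kernel)
  have a34 : finRel e [(3, 4)] ∈ T :=
    hT.finRel_mem he hE hG inter_subset_left (hT.finRel_append_mem h8 h4) h₀ (by decide +kernel)
  have a31 : finRel e [(3, 1)] ∈ T :=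
    hT.finRel_mem he hE hE inter_subset_left (hT.finRel_append_mem a32 h6) hD (by decide +kernel)
  have a14 : finRel e [(1, 4)] ∈ T :=
    hT.finRel_mem he hE hE inter_subset_left (hT.finRel_append_mem h8 h6)
      (hT.finRel_append_mem a34 h10) (by decide +kernel)
  have a24 : finRel e [(2, 4)] ∈ T :=
    hT.finRel_mem he hE hB inter_subset_left (hT.finRel_append_mem a14 h6) h2 (by decide +kernel)
  have h11 : finRel e [(3, 4), (4, 3), (5, 6), (6, 5)] ∈ T :=
    hT.finRel_mem he hE hG inter_subset_left (hT.finRel_append_mem h7 h1) h₀ (by decide +kernel)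
  have h12 : finRel e [(0, 2), (3, 1), (4, 1)] ∈ T :=
    hT.finRel_mem he hE hE inter_subset_left (hT.finRel_append_mem h11 h5)
      (hT.finRel_append_mem h9 h6) (by decide +kernel)
  have a43 : finRel e [(4, 3)] ∈ T :=
    hT.finRel_mem he hE hG inter_subset_left (hT.finRel_append_mem h12 h10) h₀ (by decide +kernel)
  have a13 : finRel e [(1, 3)] ∈ T :=
    hT.finRel_mem he hE hA inter_subset_left (hT.finRel_append_mem a14 a43) h₀ (by decide +kernel)
  have a23 : finRel e [(2, 3)] ∈ T :=
    hT.finRel_mem he hE hB inter_subset_left (hT.finRel_append_mem a24 a43) h₀ (by decide +kernel)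
  have a42 : finRel e [(4, 2)] ∈ T :=
    hT.finRel_mem he hE hA inter_subset_left (hT.finRel_append_mem a43 a32) h₀ (by decide +kernel)
  have a12 : finRel e [(1, 2)] ∈ T :=
    hT.finRel_mem he hE hG inter_subset_left (hT.finRel_append_mem a13 a32) h₀ (by decide +kernel)
  have a21 : finRel e [(2, 1)] ∈ T :=
    hT.finRel_mem he hE hG inter_subset_left (hT.finRel_append_mem a23 a31) h₀ (by decide +kernel)
  have a41 : finRel e [(4, 1)] ∈ T :=
    hT.finRel_mem he hE hE inter_subset_left (hT.finRel_append_mem a42 a21)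
      (hT.finRel_append_mem a43 a31) (by decide +kernel)
  fin_cases i <;> simp at hi <;> fin_cases j <;> simp at hj hij <;> assumption

end Seed

section Growth

variable {α : Type u} {T : Set (Set (α × α))}

theorem QuoClosed.atomRel_self_mem (hT : QuoClosed T) (a : α) : atomRel a a ∈ T := by
  have h : atomRel a a = diagRel α :=
    (atomRel_subset isQuoRel_diagRel rfl).antisymm (diagRel_subset (isQuoRel_atomRel a a))
  exact h ▸ hT.diagRel_mem

theorem QuoClosed.finRel_mem_growth (hT : QuoClosed T) {e : Fin 5 → α}
    (he : Function.Injective e) {A X : Set (α × α)}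
    (hA : IsBase T e 0 A fun i j => decide (![0, 1, 0, 1, 1] i = ![0, 1, 0, 1, 1] j))
    (hX : IsBase T e 4 X fun i j => decide (![0, 0, 1, 1, 2] i = ![0, 0, 1, 1, 2] j))
    (hXA : X ∩ A ⊆ diagRel α) (h : ∀ i j, i ≠ 3 → j ≠ 3 → finRel e [(i, j)] ∈ T) :
    finRel e [(1, 3)] ∈ T ∧ finRel e [(3, 1)] ∈ T ∧
      finRel e [(3, 4)] ∈ T ∧ finRel e [(4, 3)] ∈ T := by
  have hE := isBase_diagRel hT he
  have h₀ : finRel e [] ∈ T := hT.diagRel_mem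
  have h12 := hT.finRel_append_mem (h 1 2 (by decide) (by decide)) (h 2 1 (by decide) (by decide))
  have hZ : finRel e [(1, 3), (3, 1), (0, 2), (2, 0)] ∈ T :=
    hT.finRel_mem he hX hA hXA h12 h₀ (by decide +kernel)
  have hZ' : finRel e [(0, 1), (1, 0), (2, 3), (3, 2)] ∈ T :=
    hT.finRel_mem he hE hX inter_subset_left (hT.finRel_append_mem hZ h12) h₀ (by decide +kernel)
  have h14 := h 1 4 (by decide) (by decide)
  have h41 := h 4 1 (by decide) (by decide)
  have h34 : finRel e [(3, 4)] ∈ T :=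
    hT.finRel_mem he hE hE inter_subset_left (hT.finRel_append_mem hZ h14)
      (hT.finRel_append_mem hZ' (h 2 4 (by decide) (by decide))) (by decide +kernel)
  have h43 : finRel e [(4, 3)] ∈ T :=
    hT.finRel_mem he hE hE inter_subset_left (hT.finRel_append_mem hZ h41)
      (hT.finRel_append_mem hZ' (h 4 2 (by decide) (by decide))) (by decide +kernel)
  have h13 : finRel e [(1, 3)] ∈ T :=
    hT.finRel_mem he hE hE inter_subset_left (hT.finRel_append_mem h14 h43) hZ (by decide +kernel)
  have h31 : finRel e [(3, 1)] ∈ T :=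
    hT.finRel_mem he hE hE inter_subset_left (hT.finRel_append_mem h34 h41) hZ (by decide +kernel)
  exact ⟨h13, h31, h34, h43⟩

/-- `quo(a,d)` is the meet of `quo(a,b) ∨ quo(b,d)` and `quo(a,c) ∨ quo(c,d)`. -/
theorem QuoClosed.atomRel_mem_of_paths (hT : QuoClosed T) {a b c d : α}
    (he : Function.Injective ![a, b, c, d]) (hab : atomRel a b ∈ T) (hbd : atomRel b d ∈ T)
    (hac : atomRel a c ∈ T) (hcd : atomRel c d ∈ T) : atomRel a d ∈ T := by
  have hE := isBase_diagRel hT he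
  have h₁ : finRel ![a, b, c, d] ([(0, 1)] ++ [(1, 3)]) ∈ T := hT.finRel_append_mem hab hbd
  have h₂ : finRel ![a, b, c, d] ([(0, 2)] ++ [(2, 3)]) ∈ T := hT.finRel_append_mem hac hcd
  have h : finRel ![a, b, c, d] [(0, 3)] ∈ T :=
    hT.finRel_mem he hE hE inter_subset_left h₁ h₂ (by decide +kernel)
  exact h

theorem QuoClosed.atomRel_mem_insert (hT : QuoClosed T) {S : Set α}
    (hS : ∀ a ∈ S, ∀ b ∈ S, atomRel a b ∈ T) {q w v : α} (hq : q ∈ S) (hw : w ∈ S)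
    (hqw : q ≠ w) (hv : v ∉ S) (hvq : atomRel v q ∈ T) (hqv : atomRel q v ∈ T)
    (hvw : atomRel v w ∈ T) (hwv : atomRel w v ∈ T) :
    ∀ a ∈ insert v S, ∀ b ∈ insert v S, atomRel a b ∈ T := by
  have key : ∀ f ∈ S, atomRel f v ∈ T ∧ atomRel v f ∈ T := by
    intro f hf
    by_cases hfq : f = q
    · exact hfq ▸ ⟨hqv, hvq⟩
    by_cases hfw : f = w
    · exact hfw ▸ ⟨hwv, hvw⟩
    have hfv : f ≠ v := fun h => hv (h ▸ hf)
    have hqv' : q ≠ v := fun h => hv (h ▸ hq)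
    have hwv' : w ≠ v := fun h => hv (h ▸ hw)
    refine ⟨hT.atomRel_mem_of_paths (b := q) (c := w) ?_ (hS f hf q hq) hqv (hS f hf w hw) hwv,
      hT.atomRel_mem_of_paths (b := q) (c := w) ?_ hvq (hS q hq f hf) hvw (hS w hw f hf)⟩ <;>
    · intro i j hij
      fin_cases i <;> fin_cases j <;> simp_all
  intro a ha b hb
  rcases ha with rfl | ha <;> rcases hb with rfl | hb
  · exact hT.atomRel_self_mem _
  · exact (key _ hb).2
  · exact (key _ ha).1
  · exact hS _ ha _ hb

end Growth

section Positions

variable {α : Type u} {T : Set (Set (α × α))} {k : ℕ}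

/-- The equivalence relation with the same classes as `f`. -/
def kerRel (f : α → ℕ) : Set (α × α) := {p | f p.1 = f p.2}

theorem isQuoRel_kerRel (f : α → ℕ) : IsQuoRel (kerRel f) :=
  ⟨fun _ => rfl, fun _ _ _ h₁ h₂ => Eq.trans h₁ h₂⟩

theorem isBase_kerRel {pos : α → ℕ} (hpos : Function.Injective pos) {f : ℕ → ℕ}
    (hmem : kerRel (fun a => f (pos a)) ∈ T) {e : Fin k → α} {c : ℕ}
    {x : Fin k → Fin k → Bool} (hx : ∀ i j, f (pos (e i)) = f (pos (e j)) ↔ x i j = true)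
    (hc : ∀ i : Fin k, i.val < c → ∀ m, f m = f (pos (e i)) → ∃ j, m = pos (e j)) :
    IsBase T e c (kerRel fun a => f (pos a)) x where
  mem := hmem
  isQuoRel := isQuoRel_kerRel _
  mem_iff := hx
  isolated a ha i hi := by
    have H : f (pos a) ≠ f (pos (e i)) := fun h => by
      obtain ⟨j, hj⟩ := hc i hi _ h
      exact ha ⟨j, (hpos hj).symm⟩
    exact ⟨H, H.symm⟩

/-- Pairs of elements whose positions have the same parity. -/
def rowRel (pos : α → ℕ) : Set (α × α) := kerRel fun a => pos a % 2

/-- Pairs of elements whose positions are equal or form a pair `{2i - s, 2i + 1 - s}`. -/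
def pairRel (pos : α → ℕ) (s : ℕ) : Set (α × α) := kerRel fun a => (pos a + s) / 2

variable {pos : α → ℕ}

theorem rowRel_inter_pairRel (hpos : Function.Injective pos) (s : ℕ) :
    rowRel pos ∩ pairRel pos s ⊆ diagRel α := by
  rintro ⟨a, b⟩ ⟨h₁, h₂⟩
  have h₁ : pos a % 2 = pos b % 2 := h₁
  have h₂ : (pos a + s) / 2 = (pos b + s) / 2 := h₂
  exact hpos (show pos a = pos b by omega)

theorem pairRel_inter_pairRel (hpos : Function.Injective pos) :
    pairRel pos 0 ∩ pairRel pos 1 ⊆ diagRel α := by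
  rintro ⟨a, b⟩ ⟨h₁, h₂⟩
  have h₁ : (pos a + 0) / 2 = (pos b + 0) / 2 := h₁
  have h₂ : (pos a + 1) / 2 = (pos b + 1) / 2 := h₂
  exact hpos (show pos a = pos b by omega)

theorem QuoClosed.atomRel_mem_insert_of_pos (hT : QuoClosed T) (hpos : Function.Injective pos)
    {s : ℕ} (hA : rowRel pos ∈ T) (hX : pairRel pos s ∈ T) {S : Set α}
    (hS : ∀ a ∈ S, ∀ b ∈ S, atomRel a b ∈ T) {e : Fin 5 → α}
    (hrow : ∀ i j, pos (e i) % 2 = pos (e j) % 2 ↔ ![0, 1, 0, 1, 1] i = ![0, 1, 0, 1, 1] j)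
    (hpair : ∀ i j, (pos (e i) + s) / 2 = (pos (e j) + s) / 2 ↔
      ![0, 0, 1, 1, 2] i = ![0, 0, 1, 1, 2] j)
    (hiso : ∀ i : Fin 5, i.val < 4 → ∀ m, (m + s) / 2 = (pos (e i) + s) / 2 →
      ∃ j, m = pos (e j))
    (heS : ∀ i, i ≠ 3 → e i ∈ S) (hv : e 3 ∉ S) :
    ∀ a ∈ insert (e 3) S, ∀ b ∈ insert (e 3) S, atomRel a b ∈ T := by
  have he : Function.Injective e := by
    intro i j hij
    have h₁ := (hrow i j).1 (by rw [hij])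
    have h₂ := (hpair i j).1 (by rw [hij])
    clear hij
    decide +revert
  obtain ⟨h13, h31, h34, h43⟩ := hT.finRel_mem_growth he
    (isBase_kerRel (f := fun m => m % 2) hpos hA (fun i j => by simpa using hrow i j) (by simp))
    (isBase_kerRel (f := fun m => (m + s) / 2) hpos hX (fun i j => by simpa using hpair i j) hiso)
    (inter_comm _ _ ▸ rowRel_inter_pairRel hpos s)
    (fun i j hi hj => hS _ (heS i hi) _ (heS j hj))
  exact hT.atomRel_mem_insert hS (heS 4 (by decide)) (heS 1 (by decide))
    (fun h => absurd (he h) (by decide)) hv h34 h43 h31 h13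

theorem QuoClosed.atomRel_mem_of_le_four (hT : QuoClosed T) (hpos : Function.Injective pos)
    {e : Fin 9 → α} (he : ∀ i, pos (e i) = i.val) (hA : rowRel pos ∈ T) (hB : pairRel pos 0 ∈ T)
    (hG : pairRel pos 1 ∈ T) (hD : finRel e [(0, 2), (3, 1), (3, 5), (6, 4)] ∈ T) :
    ∀ a ∈ {a | pos a ≤ 4}, ∀ b ∈ {a | pos a ≤ 4}, atomRel a b ∈ T := by
  have hinj : Function.Injective e := fun i j h => by
    have := congrArg pos h
    rw [he, he] at this
    exact Fin.ext this
  have hiso : ∀ s ≤ 1, ∀ i : Fin 9, i.val < 8 → ∀ m, (m + s) / 2 = (pos (e i) + s) / 2 →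
      ∃ j, m = pos (e j) := by
    intro s hs i hi m hm
    rw [he] at hm
    exact ⟨⟨m, by omega⟩, by rw [he]⟩
  have hatom := hT.finRel_mem_seed hinj
    (isBase_kerRel (f := fun m => m % 2) hpos hA (fun i j => by simp [he]) (by simp))
    (isBase_kerRel (f := fun m => (m + 0) / 2) hpos hB (fun i j => by simp [he])
      (hiso 0 (by simp)))
    (isBase_kerRel (f := fun m => (m + 1) / 2) hpos hG (fun i j => by simp [he])
      (hiso 1 le_rfl))
    (rowRel_inter_pairRel hpos 0) (rowRel_inter_pairRel hpos 1) (pairRel_inter_pairRel hpos) hD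
  have hS : ∀ a ∈ e '' {i | 1 ≤ i.val ∧ i.val ≤ 4}, ∀ b ∈ e '' {i | 1 ≤ i.val ∧ i.val ≤ 4},
      atomRel a b ∈ T := by
    rintro _ ⟨i, hi, rfl⟩ _ ⟨j, hj, rfl⟩
    by_cases hij : i = j
    · exact hij ▸ hT.atomRel_self_mem _
    · exact hatom i j hi hj hij
  have key := hT.atomRel_mem_insert_of_pos hpos (s := 0) hA hB hS (e := e ∘ ![3, 2, 1, 0, 4])
    (by simp only [Function.comp_apply, he]; decide)
    (by simp only [Function.comp_apply, he]; decide)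
    (by
      intro i hi m hm
      simp only [Function.comp_apply, he] at hm ⊢
      have hm' : m < 4 := by
        have : (![3, 2, 1, 0, 4] i : Fin 9).val < 4 := by
          clear hm
          decide +revert
        omega
      clear hm
      interval_cases m
      exacts [⟨3, rfl⟩, ⟨2, rfl⟩, ⟨1, rfl⟩, ⟨0, rfl⟩])
    (fun i hi => ⟨_, by decide +revert, rfl⟩)
    (by
      rintro ⟨i, hi, h⟩
      have : i = 0 := hinj h
      simp [this] at hi)
  have hsub : ∀ a ∈ {a | pos a ≤ 4},
      a ∈ insert ((e ∘ ![3, 2, 1, 0, 4]) 3) (e '' {i | 1 ≤ i.val ∧ i.val ≤ 4}) := by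
    intro a ha
    have ha : pos a ≤ 4 := ha
    obtain ⟨i, hi⟩ : ∃ i : Fin 9, i.val = pos a := ⟨⟨pos a, by omega⟩, rfl⟩
    obtain rfl : e i = a := hpos ((he i).trans hi)
    by_cases h0 : i = 0
    · exact Or.inl (h0 ▸ rfl)
    · exact Or.inr ⟨i, ⟨by have := Fin.val_ne_of_ne h0; simp at this; omega, by omega⟩, rfl⟩
  exact fun a ha b hb => key a (hsub a ha) b (hsub b hb)

theorem QuoClosed.atomRel_mem_of_pos (hT : QuoClosed T) (hpos : Function.Injective pos)
    (hinit : ∀ a m, m ≤ pos a → ∃ b, pos b = m) (hA : rowRel pos ∈ T)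
    (hX : ∀ s ≤ 1, pairRel pos s ∈ T)
    (h4 : ∀ a ∈ {a | pos a ≤ 4}, ∀ b ∈ {a | pos a ≤ 4}, atomRel a b ∈ T) (a b : α) :
    atomRel a b ∈ T := by
  suffices H : ∀ n, 4 ≤ n → ∀ a ∈ {a | pos a ≤ n}, ∀ b ∈ {a | pos a ≤ n}, atomRel a b ∈ T from
    H (4 + pos a + pos b) (by omega) a (show pos a ≤ _ by omega) b (show pos b ≤ _ by omega)
  intro n hn
  induction n, hn using Nat.le_induction with
  | base => exact h4
  | succ n hn ih =>
    by_cases hv : ∃ v, pos v = n + 1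
    swap
    · have hsub : ∀ a ∈ {a | pos a ≤ n + 1}, a ∈ {a | pos a ≤ n} := fun a ha =>
        Nat.le_of_lt_succ (lt_of_le_of_ne ha fun h => hv ⟨a, h⟩)
      exact fun a ha b hb => ih a (hsub a ha) b (hsub b hb)
    obtain ⟨v, hv⟩ := hv
    obtain ⟨m, rfl⟩ : ∃ m, n = m + 3 := ⟨n - 3, by omega⟩
    have hex : ∀ i : Fin 5, ∃ a, pos a = m + (![1, 2, 3, 4, 0] : Fin 5 → ℕ) i := fun i =>
      hinit v _ (by rw [hv]; fin_cases i <;> simp; omega)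
    choose e he using hex
    have hev : e 3 = v := hpos ((he 3).trans hv.symm)
    obtain ⟨s, hs, hms⟩ : ∃ s ≤ 1, (m + 1 + s) % 2 = 0 := ⟨(m + 1) % 2, by omega, by omega⟩
    have key := hT.atomRel_mem_insert_of_pos hpos hA (hX s hs) ih (e := e)
      (fun i j => by
        rw [he, he]
        fin_cases i <;> fin_cases j <;> simp <;> omega)
      (fun i j => by
        rw [he, he]
        fin_cases i <;> fin_cases j <;> simp <;> omega)
      (fun i hi x hx => by
        have hx : x = m + 1 ∨ x = m + 2 ∨ x = m + 3 ∨ x = m + 4 := by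
          rw [he] at hx
          fin_cases i <;> simp at hx hi <;> omega
        rcases hx with rfl | rfl | rfl | rfl
        exacts [⟨0, (he 0).symm⟩, ⟨1, (he 1).symm⟩, ⟨2, (he 2).symm⟩, ⟨3, (he 3).symm⟩])
      (fun i hi => by
        show pos (e i) ≤ m + 3
        rw [he]
        fin_cases i <;> simp at hi ⊢)
      (by
        show ¬ pos (e 3) ≤ m + 3
        rw [hev, hv]
        omega)
    have hsub : ∀ a ∈ {a | pos a ≤ m + 3 + 1}, a ∈ insert (e 3) {a | pos a ≤ m + 3} := by
      intro a ha
      rcases Nat.le_succ_iff.1 (show pos a ≤ m + 3 + 1 from ha) with h | h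
      · exact Or.inr h
      · exact Or.inl (hpos (by rw [h, hev, hv]))
    exact fun a ha b hb => key a (hsub a ha) b (hsub b hb)

theorem quoOneOneTwoGenerated_of_pos (hpos : Function.Injective pos)
    (hinit : ∀ a m, m ≤ pos a → ∃ b, pos b = m) (h8 : ∃ a, pos a = 8) :
    QuoOneOneTwoGenerated α := by
  obtain ⟨a₈, h8⟩ := h8
  have hex : ∀ i : Fin 9, ∃ a, pos a = i.val := fun i => hinit a₈ _ (by omega)
  choose e he using hex
  have hinj : Function.Injective e := fun i j h => by
    have := congrArg pos h
    rw [he, he] at this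
    exact Fin.ext this
  set L : List (Fin 9 × Fin 9) := [(0, 2), (3, 1), (3, 5), (6, 4)] with hL
  have hDloc := (isBase_diagRel (T := univ) ⟨fun _ _ => trivial, fun _ _ => trivial⟩
    hinj).isLocal_addPairs (L := L) fun p _ => ⟨p.1.isLt, p.2.isLt⟩
  have hD : ∀ i j, (e i, e j) ∈ finRel e L ↔ addPairsMat (diagMat 9) L i j = true :=
    hDloc.mem_iff
  have hA : ∀ i j, (e i, e j) ∈ rowRel pos ↔ i.val % 2 = j.val % 2 := fun i j => by
    simp [rowRel, kerRel, he]
  have hX : ∀ s i j, (e i, e j) ∈ pairRel pos s ↔ (i.val + s) / 2 = (j.val + s) / 2 :=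
    fun s i j => by simp [pairRel, kerRel, he]
  have hDA : finRel e L ⊆ rowRel pos :=
    addPairs_subset (isQuoRel_kerRel _) (diagRel_subset (isQuoRel_kerRel _)) (by
      simp only [hL, List.map_cons, List.map_nil, Prod.map_apply, List.mem_cons, List.not_mem_nil,
        or_false]
      rintro p (rfl | rfl | rfl | rfl) <;> exact (hA _ _).2 (by decide))
  have not_sub : ∀ {R S : Set (α × α)} (i j : Fin 9), (e i, e j) ∈ R → (e i, e j) ∉ S → ¬ R ⊆ S :=
    fun i j hR hS h => hS (h hR)
  refine ⟨finRel e L, rowRel pos, pairRel pos 0, pairRel pos 1, ⟨hDA, ?_⟩, ⟨?_, ?_⟩, ⟨?_, ?_⟩,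
    ⟨?_, ?_⟩, ⟨?_, ?_⟩, ⟨?_, ?_⟩, ?_, ?_⟩
  · exact not_sub 2 0 (by rw [hA]; decide) (by rw [hD]; decide +kernel)
  · exact not_sub 0 2 (by rw [hD]; decide +kernel) (by rw [hX]; decide)
  · exact not_sub 0 1 (by rw [hX]; decide) (by rw [hD]; decide +kernel)
  · exact not_sub 0 2 (by rw [hD]; decide +kernel) (by rw [hX]; decide)
  · exact not_sub 1 2 (by rw [hX]; decide) (by rw [hD]; decide +kernel)
  · exact not_sub 0 2 (by rw [hA]; decide) (by rw [hX]; decide)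
  · exact not_sub 0 1 (by rw [hX]; decide) (by rw [hA]; decide)
  · exact not_sub 0 2 (by rw [hA]; decide) (by rw [hX]; decide)
  · exact not_sub 1 2 (by rw [hX]; decide) (by rw [hA]; decide)
  · exact not_sub 0 1 (by rw [hX]; decide) (by rw [hX]; decide)
  · exact not_sub 1 2 (by rw [hX]; decide) (by rw [hX]; decide)
  · rintro _ (rfl | rfl | rfl | rfl)
    exacts [isQuoRel_diagRel.addPairs _, isQuoRel_kerRel _, isQuoRel_kerRel _, isQuoRel_kerRel _]
  · intro T hTQ hsub hT
    refine hTQ.antisymm fun r hr => hT.mem_of_atomRel_mem ?_ hr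
    have hDT : finRel e L ∈ T := hsub (by simp)
    have hAT : rowRel pos ∈ T := hsub (by simp)
    have hBT : pairRel pos 0 ∈ T := hsub (by simp)
    have hGT : pairRel pos 1 ∈ T := hsub (by simp)
    refine hT.atomRel_mem_of_pos hpos hinit hAT (fun s hs => ?_)
      (hT.atomRel_mem_of_le_four hpos he hAT hBT hGT hDT)
    interval_cases s <;> assumption

end Positions

/-- If `58 ≤ |A| ≤ ℵ₀` and `|A|` is even (with `ℵ₀` regarded as even), then the
complete lattice `Quo(A)` is `(1+1+2)`-generated. -/
theorem quo_one_one_two_generated_even {α : Type u}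
    (h58 : 58 ≤ Cardinal.mk α) (hle : Cardinal.mk α ≤ Cardinal.aleph0)
    (heven : (∃ n : ℕ, Cardinal.mk α = n ∧ Even n) ∨ Cardinal.mk α = Cardinal.aleph0) :
    QuoOneOneTwoGenerated α := by
  rcases hle.lt_or_eq with hfin | hinf
  · obtain ⟨n, hn⟩ := Cardinal.lt_aleph0.1 hfin
    have : Finite α := Cardinal.lt_aleph0_iff_finite.1 hfin
    have hcard : Nat.card α = n := by rw [Nat.card, hn, Cardinal.toNat_natCast]
    have h58n : 58 ≤ n := by
      rw [hn] at h58
      exact_mod_cast h58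
    let f : α ≃ Fin n := Finite.equivFinOfCardEq hcard
    refine quoOneOneTwoGenerated_of_pos (pos := fun a => (f a).val)
      (Fin.val_injective.comp f.injective) (fun a m hm => ?_) ?_
    · exact ⟨f.symm ⟨m, hm.trans_lt (f a).isLt⟩, by simp⟩
    · exact ⟨f.symm ⟨8, by omega⟩, by simp⟩
  · have : Countable α := Cardinal.mk_le_aleph0_iff.1 hle
    have : Infinite α := Cardinal.infinite_iff.2 hinf.ge
    obtain ⟨f⟩ : Nonempty (α ≃ ℕ) := nonempty_equiv_of_countable
    exact quoOneOneTwoGenerated_of_pos f.injective (fun a m _ => ⟨f.symm m, by simp⟩)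
      ⟨f.symm 8, by simp⟩
end

section
/- Let A be a set. For any two distinct elements a ≠ b of A, the quasiorder quo(a,b) (the least quasiorder on A containing the pair (a,b)) is an atom of the complete lattice Quo(A); conversely, every atom of Quo(A) equals quo(a,b) for some pair of distinct elements a ≠ b of A. -/
universe u

open Set

/-- An atom of `Quo(α)`: a quasiorder covering the least element (the diagonal). -/
def QuoAtom {α : Type u} (r : Set (α × α)) : Prop :=
  IsQuoRel r ∧ r ≠ diagRel α ∧ ∀ s : Set (α × α), IsQuoRel s → s ⊆ r →
    s = diagRel α ∨ s = r

theorem IsQuoRel.diagRel_subset {α : Type u} {r : Set (α × α)} (hr : IsQuoRel r) :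
    diagRel α ⊆ r := by
  rintro ⟨x, y⟩ (rfl : x = y)
  exact hr.1 x

theorem isQuoRel_insert_diagRel {α : Type u} (a b : α) :
    IsQuoRel (insert (a, b) (diagRel α)) := by
  refine ⟨fun x => Or.inr rfl, fun x y z hxy hyz => ?_⟩
  simp only [diagRel, mem_insert_iff, Prod.mk.injEq, mem_ofPred_eq] at hxy hyz ⊢
  grind

/-- The least quasiorder containing `(a, b)` is the diagonal with the pair `(a, b)` added. -/
theorem quoPair_eq_insert_diagRel {α : Type u} (a b : α) :
    quoPair a b = insert (a, b) (diagRel α) := by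
  apply Subset.antisymm
  · exact sInter_subset_of_mem
      ⟨isQuoRel_insert_diagRel a b, singleton_subset_iff.2 (mem_insert _ _)⟩
  · exact subset_sInter fun s hs => insert_subset (hs.2 rfl) hs.1.diagRel_subset

/-- For distinct `a ≠ b`, `quo(a,b)` is an atom of `Quo(A)`, and every atom of `Quo(A)`
is of this form. -/
theorem quo_atoms_characterization {α : Type u} :
    (∀ a b : α, a ≠ b → QuoAtom (quoPair a b)) ∧
      ∀ r : Set (α × α), QuoAtom r → ∃ a b : α, a ≠ b ∧ r = quoPair a b := by
  constructor
  · intro a b hab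
    rw [quoPair_eq_insert_diagRel]
    refine ⟨isQuoRel_insert_diagRel a b, fun h => hab ?_, fun s hs hsub => ?_⟩
    · exact (h ▸ mem_insert (a, b) (diagRel α) : (a, b) ∈ diagRel α)
    · by_cases hmem : (a, b) ∈ s
      · exact Or.inr (hsub.antisymm (insert_subset hmem hs.diagRel_subset))
      · exact Or.inl (((subset_insert_iff_of_notMem hmem).1 hsub).antisymm hs.diagRel_subset)
  · rintro r ⟨hr, hne, hmin⟩
    obtain ⟨⟨a, b⟩, hmem, hab⟩ := not_subset.1 fun h => hne (h.antisymm hr.diagRel_subset)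
    refine ⟨a, b, hab, ?_⟩
    rw [quoPair_eq_insert_diagRel]
    refine ((hmin _ (isQuoRel_insert_diagRel a b)
      (insert_subset hmem hr.diagRel_subset)).resolve_left fun h => hab ?_).symm
    exact h ▸ mem_insert (a, b) (diagRel α)
end
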